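/- Let H be a complex Hilbert space, P a symmetric (possibly unbounded, densely defined) operator on H, E a real number, ε > 0, and w : H → H a bounded positive self-adjoint weight operator with bounded inverse. Suppose that for some M > 0 and all f in the domain of P one has ‖w⁻¹ f‖² ≤ M ‖w (P − E + iε) f‖² + M ε ‖f‖². Then for all f in the domain of P, ‖w⁻¹ f‖ ≤ (M+1) ‖w (P − E + iε) f‖. -/

import Mathlib

open scoped InnerProductSpace ComplexConjugate

/-- Abstract content of Lemma 2.1: `P` is a (possibly unbounded) symmetric operator with
domain `D` in a complex Hilbert space, `w` a bounded positive self-adjoint weight with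
bounded inverse `winv`. If `‖winv f‖² ≤ M ‖w (P - E + iε) f‖² + M ε ‖f‖²` on the domain,
then `‖winv f‖ ≤ (M+1) ‖w (P - E + iε) f‖` on the domain. -/
theorem stmt_0 {H : Type*} [NormedAddCommGroup H] [InnerProductSpace ℂ H] [CompleteSpace H]
    (D : Submodule ℂ H) (P : H →ₗ[ℂ] H)
    (hsym : ∀ f ∈ D, ∀ g ∈ D, ⟪P f, g⟫_ℂ = ⟪f, P g⟫_ℂ)
    (E ε M : ℝ) (hε : 0 < ε) (hM : 0 < M)
    (w winv : H →L[ℂ] H) (hw_sa : IsSelfAdjoint w)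
    (hw_pos : ∀ f : H, 0 ≤ (⟪w f, f⟫_ℂ).re)
    (hinv₁ : ∀ f : H, winv (w f) = f) (hinv₂ : ∀ f : H, w (winv f) = f)
    (hbound : ∀ f ∈ D,
      ‖winv f‖ ^ 2 ≤
        M * ‖w (P f - (E : ℂ) • f + (ε * Complex.I) • f)‖ ^ 2 + M * ε * ‖f‖ ^ 2) :
    ∀ f ∈ D, ‖winv f‖ ≤ (M + 1) * ‖w (P f - (E : ℂ) • f + (ε * Complex.I) • f)‖ := by
  intro f hf
  have hb := hbound f hf
  have h0 : (⟪f, P f⟫_ℂ).im = 0 := by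
    have h1 := congrArg Complex.im (hsym f hf f hf)
    rw [← inner_conj_symm, Complex.conj_im] at h1
    linarith
  have hff : ⟪f, f⟫_ℂ = ((‖f‖ ^ 2 : ℝ) : ℂ) := by
    rw [inner_self_eq_norm_sq_to_K]; norm_cast
  have him : (⟪f, P f - (E : ℂ) • f + (ε * Complex.I) • f⟫_ℂ).im = ε * ‖f‖ ^ 2 := by
    rw [inner_add_right, inner_sub_right, inner_smul_right, inner_smul_right, hff,
      Complex.add_im, Complex.sub_im, h0, Complex.im_ofReal_mul, mul_assoc,
      Complex.im_ofReal_mul, Complex.ofReal_im, Complex.I_mul_im, Complex.ofReal_re]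
    ring
  generalize P f - (E : ℂ) • f + (ε * Complex.I) • f = g at *
  have hswap : ⟪f, g⟫_ℂ = ⟪winv f, w g⟫_ℂ := by
    conv_lhs => rw [← hinv₂ f]
    exact hw_sa.isSymmetric (winv f) g
  have hcs : ε * ‖f‖ ^ 2 ≤ ‖winv f‖ * ‖w g‖ := by
    rw [← him, hswap]
    exact ((le_abs_self _).trans (Complex.abs_im_le_norm _)).trans (norm_inner_le_norm _ _)
  have ha := norm_nonneg (winv f)
  have hb0 := norm_nonneg (w g)
  generalize ‖winv f‖ = a at *
  generalize ‖w g‖ = b at *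
  have key : a ^ 2 ≤ M * b ^ 2 + M * (a * b) := by
    have := mul_le_mul_of_nonneg_left hcs hM.le
    linarith
  by_contra! hlt
  have hMb : 0 ≤ M * b := by positivity
  have hab : b ≤ a := by linarith
  have hapos : 0 < a := by linarith
  have h1 : (M + 1) * b * a < a * a := mul_lt_mul_of_pos_right hlt hapos
  have h2 : b * ((M + 1) * b) ≤ b * a := mul_le_mul_of_nonneg_left hlt.le hb0
  nlinarith [sq_nonneg b]
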